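/- arXiv:1611.03310 — 2 statements merged into one kernel-verified Lean document; each statement's English description precedes it below -/
import Mathlib

section
/- ω(6) = 10: the greatest length of a run of consecutive integers each divisible by one of the primes 3, 5, 7, 11, 13 is exactly 10; a witness is a = 12227, where a+1,…,a+10 are each divisible by one of these primes, and no run of 11 consecutive integers has this property. -/
theorem three_le_card_coprime_105 :
    ∀ r < 105, 3 ≤ ((Finset.Icc 1 11).filter fun q : ℕ =>
      (r + q) % 3 ≠ 0 ∧ (r + q) % 5 ≠ 0 ∧ (r + q) % 7 ≠ 0).card := by
  decide +kernel

theorem card_filter_dvd_add_le_one (a : ℤ) {p : ℕ} (hp : 11 ≤ p) :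
    ((Finset.Icc 1 11).filter fun q : ℕ => (p : ℤ) ∣ a + q).card ≤ 1 := by
  refine Finset.card_le_one.2 fun x hx y hy => ?_
  simp only [Finset.mem_filter, Finset.mem_Icc] at hx hy
  have h := Int.eq_zero_of_abs_lt_dvd (dvd_sub hx.2 hy.2) (abs_lt.2 (by omega))
  omega

theorem stmt_16 :
    (∀ q : ℕ, 1 ≤ q → q ≤ 10 →
      ∃ p ∈ ({3, 5, 7, 11, 13} : Finset ℕ), (p : ℤ) ∣ (12227 + q)) ∧
    ¬ ∃ a : ℤ, ∀ q : ℕ, 1 ≤ q → q ≤ 11 →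
      ∃ p ∈ ({3, 5, 7, 11, 13} : Finset ℕ), (p : ℤ) ∣ (a + q) := by
  constructor
  · intro q h₁ h₂
    interval_cases q <;> decide
  · rintro ⟨a, ha⟩
    obtain ⟨r, hr⟩ := Int.eq_ofNat_of_zero_le (Int.emod_nonneg a (by norm_num : (105 : ℤ) ≠ 0))
    have hcard := three_le_card_coprime_105 r (by omega)
    have hsub : ((Finset.Icc 1 11).filter fun q : ℕ =>
        (r + q) % 3 ≠ 0 ∧ (r + q) % 5 ≠ 0 ∧ (r + q) % 7 ≠ 0) ⊆
        ((Finset.Icc 1 11).filter fun q : ℕ => ((11 : ℕ) : ℤ) ∣ a + q) ∪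
        ((Finset.Icc 1 11).filter fun q : ℕ => ((13 : ℕ) : ℤ) ∣ a + q) := by
      intro q hq
      simp only [Finset.mem_union, Finset.mem_filter, Finset.mem_Icc] at hq ⊢
      obtain ⟨p, hp, hdvd⟩ := ha q hq.1.1 hq.1.2
      simp only [Finset.mem_insert, Finset.mem_singleton] at hp
      rcases hp with rfl | rfl | rfl | rfl | rfl
      · omega
      · omega
      · omega
      · exact Or.inl ⟨hq.1, hdvd⟩
      · exact Or.inr ⟨hq.1, hdvd⟩
    have hle := (Finset.card_le_card hsub).trans (Finset.card_union_le _ _)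
    have h11 := card_filter_dvd_add_le_one a (le_refl 11)
    have h13 := card_filter_dvd_add_le_one a (by norm_num : 11 ≤ 13)
    omega
end

section
/- Let p_2,…,p_n be distinct primes and m a positive integer such that some choice of residues a_i ∈ {1,…,p_i−1} covers {1,…,m} (every q in {1,…,m} is ≡ a_i mod p_i for some i) and m is the maximum such coverable length. Then for every index j ∈ {2,…,n} there exists q ∈ {1,…,m} with q ≡ a_j (mod p_j) and q ≢ a_i (mod p_i) for all i ≠ j (i.e., every prime contributes a position covered only by it). -/
/-- A system of residue classes to distinct prime moduli leaves some nonpositive integer `-a`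
uncovered. -/
lemma exists_forall_not_dvd_add {k : ℕ} {p : Fin k → ℕ} (hp : ∀ i, (p i).Prime)
    (hinj : Function.Injective p) (s : Fin k → ℕ) : ∃ a : ℕ, ∀ i, ¬ p i ∣ s i + a := by
  obtain ⟨a, ha⟩ := Nat.chineseRemainderOfFinset (fun i => 1 + (p i - 1) * s i) p Finset.univ
    (fun i _ => (hp i).ne_zero)
    (fun i _ l _ hil => (Nat.coprime_primes (hp i) (hp l)).2 (hinj.ne hil))
  refine ⟨a, fun i hdvd => ?_⟩
  have h1 : s i + a ≡ s i + (1 + (p i - 1) * s i) [MOD p i] :=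
    (ha i (Finset.mem_univ i)).add_left (s i)
  have h2 : s i + (1 + (p i - 1) * s i) = p i * s i + 1 := by
    obtain ⟨t, ht⟩ := Nat.exists_eq_add_of_le (hp i).one_le
    rw [ht, Nat.add_sub_cancel_left]
    ring
  rw [h2] at h1
  have h3 : p i ∣ p i * s i + 1 := (h1.dvd_iff dvd_rfl).1 hdvd
  exact (hp i).one_lt.ne' (Nat.dvd_one.1 ((Nat.dvd_add_right (dvd_mul_right _ _)).1 h3))

/-- If arbitrary residue classes to distinct prime moduli cover `{1, …, n}`, then a translate of
them consists of nonzero classes and covers an initial segment at least as long. -/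
lemma exists_nonzero_residues_cover {k : ℕ} {p : Fin k → ℕ} (hp : ∀ i, (p i).Prime)
    (hinj : Function.Injective p) {n : ℕ} (s : Fin k → ℕ)
    (hcov : ∀ q : ℕ, 1 ≤ q → q ≤ n → ∃ i, q ≡ s i [MOD p i]) :
    ∃ n' ≥ n, ∃ r : Fin k → ℕ, (∀ i, 1 ≤ r i ∧ r i ≤ p i - 1) ∧
      ∀ q : ℕ, 1 ≤ q → q ≤ n' → ∃ i, q ≡ r i [MOD p i] := by
  classical
  have hex := exists_forall_not_dvd_add hp hinj s
  obtain ⟨a, ha, hmin⟩ : ∃ a : ℕ, (∀ i, ¬ p i ∣ s i + a) ∧ ∀ b < a, ∃ i, p i ∣ s i + b :=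
    ⟨Nat.find hex, Nat.find_spec hex, fun b hb => by simpa using Nat.find_min hex hb⟩
  refine ⟨n + a, Nat.le_add_right n a, fun i => (s i + a) % p i, fun i => ⟨?_, ?_⟩, ?_⟩
  · exact Nat.pos_of_ne_zero fun h => ha i (Nat.dvd_of_mod_eq_zero h)
  · exact Nat.le_sub_one_of_lt (Nat.mod_lt _ (hp i).pos)
  · intro q hq1 hqn
    suffices h : ∃ i, q ≡ s i + a [MOD p i] from
      h.imp fun i hi => hi.trans (Nat.mod_modEq _ _).symm
    rcases lt_or_ge a q with haq | hqa
    · obtain ⟨i, hi⟩ := hcov (q - a) (by omega) (by omega)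
      refine ⟨i, ?_⟩
      simpa [Nat.sub_add_cancel haq.le] using hi.add_right a
    · obtain ⟨i, hi⟩ := hmin (a - q) (by omega)
      refine ⟨i, ?_⟩
      have h := ((Nat.modEq_zero_iff_dvd.2 hi).add_right q).symm
      rwa [zero_add, add_assoc, Nat.sub_add_cancel hqa] at h

theorem stmt_19 (k : ℕ) (p : Fin k → ℕ) (hp : ∀ i, (p i).Prime)
    (hinj : Function.Injective p) (m : ℕ) (hm : 0 < m)
    (r : Fin k → ℕ) (hr : ∀ i, 1 ≤ r i ∧ r i ≤ p i - 1)
    (hcov : ∀ q : ℕ, 1 ≤ q → q ≤ m → ∃ i, q ≡ r i [MOD p i])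
    (hmax : ∀ m' : ℕ, m < m' → ∀ r' : Fin k → ℕ,
      (∀ i, 1 ≤ r' i ∧ r' i ≤ p i - 1) →
      ¬ (∀ q : ℕ, 1 ≤ q → q ≤ m' → ∃ i, q ≡ r' i [MOD p i])) :
    ∀ j, ∃ q : ℕ, 1 ≤ q ∧ q ≤ m ∧ q ≡ r j [MOD p j] ∧
      ∀ i, i ≠ j → ¬ (q ≡ r i [MOD p i]) := by
  intro j
  by_contra! hj
  have hcov' : ∀ q : ℕ, 1 ≤ q → q ≤ m + 1 →
      ∃ i, q ≡ Function.update r j (m + 1) i [MOD p i] := by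
    intro q hq1 hqm
    rcases Nat.le_succ_iff.1 hqm with hq | rfl
    · obtain ⟨i, hij, hi⟩ : ∃ i, i ≠ j ∧ q ≡ r i [MOD p i] := by
        obtain ⟨i, hi⟩ := hcov q hq1 hq
        by_cases hij : i = j
        · exact hj q hq1 hq (hij ▸ hi)
        · exact ⟨i, hij, hi⟩
      exact ⟨i, by rwa [Function.update_of_ne hij]⟩
    · exact ⟨j, by rw [Function.update_self]⟩
  obtain ⟨m', hm', r', hr', hc⟩ := exists_nonzero_residues_cover hp hinj _ hcov'
  exact hmax m' hm' r' hr' hc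
end
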